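/- Every light tournament T with weight function w : V(T) → ℚ≥0 has a feedback vertex set F' with w(F') ≤ (3/4)·w(V(T)). -/

import Mathlib

variable {V : Type*}

/-- A directed triangle: arcs `a → b`, `b → c`, `c → a`. -/
def Triangle (arc : V → V → Prop) (a b c : V) : Prop :=
  arc a b ∧ arc b c ∧ arc c a

/-- A tournament: an irreflexive relation with exactly one arc between any two
distinct vertices. -/
def IsTournament (arc : V → V → Prop) : Prop :=
  (∀ v, ¬ arc v v) ∧ ∀ a b : V, a ≠ b → (arc a b ↔ ¬ arc b a)

/-- A feedback vertex set: removing `X` leaves no directed triangle. -/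
def IsFVS (arc : V → V → Prop) (X : Set V) : Prop :=
  ∀ a b c : V, a ∉ X → b ∉ X → c ∉ X → ¬ Triangle arc a b c

/-- The pair `{a,b}` is a diagonal: there are `u, v` such that both `{u,v,a}` and
`{u,v,b}` are triangles. -/
def IsDiagonal (arc : V → V → Prop) (a b : V) : Prop :=
  ∃ u v : V, Triangle arc u v a ∧ Triangle arc u v b

/-- A heavy triangle: a triangle at least two of whose vertex pairs are diagonals. -/
def HeavyTriangle (arc : V → V → Prop) (a b c : V) : Prop :=
  Triangle arc a b c ∧
  ((IsDiagonal arc a b ∧ IsDiagonal arc b c) ∨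
   (IsDiagonal arc a b ∧ IsDiagonal arc a c) ∨
   (IsDiagonal arc b c ∧ IsDiagonal arc a c))

/-- A tournament is heavy if it contains a heavy triangle. -/
def IsHeavy (arc : V → V → Prop) : Prop := ∃ a b c : V, HeavyTriangle arc a b c

/-- A tournament is light if it is not heavy. -/
def IsLight (arc : V → V → Prop) : Prop := ¬ IsHeavy arc

theorem IsTournament.asymm {arc : V → V → Prop} (hT : IsTournament arc) {a b : V}
    (h : arc a b) : ¬ arc b a := by
  have hne : a ≠ b := fun e => hT.1 a (by simpa [← e] using h)
  exact (hT.2 a b hne).1 h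

theorem IsTournament.of_not {arc : V → V → Prop} (hT : IsTournament arc) {a b : V}
    (hne : a ≠ b) (h : ¬ arc a b) : arc b a := by
  by_contra h'
  exact h ((hT.2 a b hne).2 h')

theorem IsTournament.flip {arc : V → V → Prop} (hT : IsTournament arc) :
    IsTournament (flip arc) :=
  ⟨hT.1, fun a b hne => hT.2 b a hne.symm⟩

theorem Triangle.rotate {arc : V → V → Prop} {a b c : V} (h : Triangle arc a b c) :
    Triangle arc b c a :=
  ⟨h.2.1, h.2.2, h.1⟩

theorem IsDiagonal.symm {arc : V → V → Prop} {a b : V} (h : IsDiagonal arc a b) :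
    IsDiagonal arc b a :=
  let ⟨u, v, ha, hb⟩ := h
  ⟨u, v, hb, ha⟩

theorem triangle_of_flip {arc : V → V → Prop} {a b c : V} (h : Triangle (flip arc) a b c) :
    Triangle arc b a c :=
  ⟨h.1, h.2.2, h.2.1⟩

theorem isDiagonal_of_flip {arc : V → V → Prop} {a b : V} (h : IsDiagonal (flip arc) a b) :
    IsDiagonal arc a b :=
  let ⟨u, v, ha, hb⟩ := h
  ⟨v, u, triangle_of_flip ha, triangle_of_flip hb⟩

theorem IsLight.flip {arc : V → V → Prop} (h : IsLight arc) : IsLight (flip arc) := by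
  rintro ⟨a, b, c, ht, hd⟩
  refine h ⟨b, a, c, triangle_of_flip ht, ?_⟩
  rcases hd with ⟨h₁, h₂⟩ | ⟨h₁, h₂⟩ | ⟨h₁, h₂⟩
  · exact .inr (.inl ⟨(isDiagonal_of_flip h₁).symm, isDiagonal_of_flip h₂⟩)
  · exact .inl ⟨(isDiagonal_of_flip h₁).symm, isDiagonal_of_flip h₂⟩
  · exact .inr (.inr ⟨isDiagonal_of_flip h₂, isDiagonal_of_flip h₁⟩)

/-- Two pairs of a triangle of a light tournament are not both diagonals. -/
theorem IsLight.not_diagonal {arc : V → V → Prop} (h : IsLight arc) {a b c : V}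
    (ht : Triangle arc a b c) (h₁ : IsDiagonal arc a b) (h₂ : IsDiagonal arc b c) : False :=
  h ⟨a, b, c, ht, .inl ⟨h₁, h₂⟩⟩

/-- `a` is an in-neighbour of `v` lying in a common triangle with `v`. -/
def InTriangle (arc : V → V → Prop) (v a : V) : Prop :=
  arc a v ∧ ∃ w, arc v w ∧ arc w a

/-- A vertex dominated by `v` dominates at most one vertex of a triangle whose vertices are all
triangle in-neighbours of `v`. -/
theorem not_dominates_two {arc : V → V → Prop} (hT : IsTournament arc) (hl : IsLight arc)
    {v a b c x : V} (ht : Triangle arc a b c) (ha : InTriangle arc v a)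
    (hb : InTriangle arc v b) (hc : InTriangle arc v c) (hvx : arc v x) (hxa : arc x a)
    (hxb : arc x b) : False := by
  obtain ⟨hav, -⟩ := ha
  obtain ⟨hbv, -⟩ := hb
  obtain ⟨hcv, y, hvy, hyc⟩ := hc
  have out_ne : ∀ {s t : V}, arc s v → arc v t → t ≠ s := fun hs h e =>
    hT.asymm hs (by simpa [e] using h)
  have dab : IsDiagonal arc a b := ⟨v, x, ⟨hvx, hxa, hav⟩, ⟨hvx, hxb, hbv⟩⟩
  have hcx : arc c x := hT.of_not (out_ne hcv hvx) fun hxc =>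
    hl.not_diagonal ht dab ⟨v, x, ⟨hvx, hxb, hbv⟩, ⟨hvx, hxc, hcv⟩⟩
  have hay : arc a y := hT.of_not (out_ne hav hvy) fun hya =>
    hl.not_diagonal ht.rotate.rotate ⟨v, y, ⟨hvy, hyc, hcv⟩, ⟨hvy, hya, hav⟩⟩ dab
  exact hl.not_diagonal (⟨hxa, hav, hvx⟩ : Triangle arc x a v)
    ⟨b, c, ⟨ht.2.1, hcx, hxb⟩, ⟨ht.2.1, ht.2.2, ht.1⟩⟩
    ⟨y, c, ⟨hyc, ht.2.2, hay⟩, ⟨hyc, hcv, hvy⟩⟩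

/-- The triangle in-neighbours of a vertex of a light tournament induce no triangle. -/
theorem not_triangle_of_inTriangle {arc : V → V → Prop} (hT : IsTournament arc)
    (hl : IsLight arc) {v a b c : V} (ha : InTriangle arc v a) (hb : InTriangle arc v b)
    (hc : InTriangle arc v c) : ¬ Triangle arc a b c := by
  intro ht
  have key₁ := fun x => not_dominates_two hT hl (x := x) ht ha hb hc
  have key₂ := fun x => not_dominates_two hT hl (x := x) ht.rotate hb hc ha
  have key₃ := fun x => not_dominates_two hT hl (x := x) ht.rotate.rotate hc ha hb
  obtain ⟨hav, x, hvx, hxa⟩ := ha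
  obtain ⟨hbv, y, hvy, hyb⟩ := hb
  obtain ⟨hcv, z, hvz, hzc⟩ := hc
  have out_ne : ∀ {s t : V}, arc s v → arc v t → t ≠ s := fun hs h e =>
    hT.asymm hs (by simpa [e] using h)
  have hbx : arc b x := hT.of_not (out_ne hbv hvx) (key₁ x hvx hxa)
  have hay : arc a y := hT.of_not (out_ne hav hvy) fun h => key₁ y hvy h hyb
  have hcy : arc c y := hT.of_not (out_ne hcv hvy) (key₂ y hvy hyb)
  have haz : arc a z := hT.of_not (out_ne hav hvz) (key₃ z hvz hzc)
  by_cases hxy : arc x y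
  · exact hl.not_diagonal (⟨hxa, hav, hvx⟩ : Triangle arc x a v).rotate
      ⟨z, c, ⟨hzc, ht.2.2, haz⟩, ⟨hzc, hcv, hvz⟩⟩
      ⟨y, b, ⟨hyb, hbv, hvy⟩, ⟨hyb, hbx, hxy⟩⟩
  · have hne : x ≠ y := fun e => hT.asymm hxa (by simpa [e] using hay)
    have hyx : arc y x := hT.of_not hne hxy
    exact hl.not_diagonal (⟨hyb, hbv, hvy⟩ : Triangle arc y b v).rotate
      ⟨x, a, ⟨hxa, ht.1, hbx⟩, ⟨hxa, hav, hvx⟩⟩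
      ⟨x, a, ⟨hxa, hav, hvx⟩, ⟨hxa, hay, hyx⟩⟩

/-- The triangle out-neighbours of a vertex of a light tournament induce no triangle. -/
theorem not_triangle_of_flip_inTriangle {arc : V → V → Prop} (hT : IsTournament arc)
    (hl : IsLight arc) {v a b c : V} (ha : InTriangle (flip arc) v a)
    (hb : InTriangle (flip arc) v b) (hc : InTriangle (flip arc) v c) :
    ¬ Triangle arc a b c := fun ht =>
  not_triangle_of_inTriangle hT.flip hl.flip hb ha hc
    (triangle_of_flip (arc := flip arc) ht)

/-- Every nonempty set of vertices contains a vertex reaching each of its in-neighbours in the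
set by a path of length two inside the set. -/
theorem exists_king [Finite V] {arc : V → V → Prop} (hT : IsTournament arc) {S : Set V}
    (hS : S.Nonempty) :
    ∃ v ∈ S, ∀ c ∈ S, arc c v → ∃ w ∈ S, arc v w ∧ arc w c := by
  obtain ⟨v, hv, hmax⟩ := Set.exists_max_image S (fun v => {w ∈ S | arc v w}.ncard)
    S.toFinite hS
  refine ⟨v, hv, fun c hc hcv => ?_⟩
  by_contra! hno
  refine absurd (hmax c hc) (not_le.2 (Set.ncard_lt_ncard ⟨?_, ?_⟩ (Set.toFinite _)))
  · rintro w ⟨hw, hvw⟩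
    refine ⟨hw, hT.of_not (fun e => hT.asymm hcv (by simpa [← e] using hvw)) (hno w hw hvw)⟩
  · exact fun h => hT.1 v (h ⟨hv, hcv⟩).2

/-- A partial `3`-colouring of the vertices outside `R` in which only the vertices of `O`, all of
colour `k`, may be dominated by vertices of `R`. -/
structure PartialColoring (arc : V → V → Prop) (R O : Set V) (col : V → ZMod 3)
    (k : ZMod 3) : Prop where
  dominates : ∀ x ∉ R, x ∉ O → ∀ c ∈ R, arc x c
  notMem : ∀ x ∈ O, x ∉ R
  color : ∀ x ∈ O, col x = k
  exists_arc : ∀ x ∈ O, ∃ y, y ∉ R ∧ y ∉ O ∧ arc x y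
  not_mono : ∀ a b c, a ∉ R → b ∉ R → c ∉ R → Triangle arc a b c →
    col a = col b → col b = col c → False

open Classical in
theorem PartialColoring.extend {arc : V → V → Prop} (hT : IsTournament arc) {R O X P : Set V}
    {col : V → ZMod 3} {k : ZMod 3} (h : PartialColoring arc R O col k) (hX : X ⊆ R) (hP : P ⊆ R)
    (hXP : Disjoint X P)
    (hX' : ∀ a ∈ X, ∀ b ∈ X, ∀ c ∈ X, ¬ Triangle arc a b c)
    (hP' : ∀ a ∈ P, ∀ b ∈ P, ∀ c ∈ P, ¬ Triangle arc a b c)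
    (hdom : ∀ x ∈ O ∪ X, ∀ c ∈ R \ (X ∪ P), arc x c)
    (harc : ∀ x ∈ P, ∃ y, (y ∉ R ∨ y ∈ X) ∧ arc x y) :
    ∃ col' k', PartialColoring arc (R \ (X ∪ P)) P col' k' := by
  have hdisj : ∀ x ∈ X, x ∉ P := fun x hx hp => Set.disjoint_left.1 hXP hx hp
  set col' : V → ZMod 3 := fun x => if x ∈ P then k + 2 else if x ∈ X then k + 1 else col x
    with hcol'
  have col_P : ∀ x ∈ P, col' x = k + 2 := fun x hx => by simp [hcol', hx]
  have col_X : ∀ x ∈ X, col' x = k + 1 := fun x hx => by simp [hcol', hx, hdisj x hx]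
  have col_D : ∀ x ∉ R, col' x = col x := fun x hx => by
    have hxP : x ∉ P := fun hp => hx (hP hp)
    have hxX : x ∉ X := fun hp => hx (hX hp)
    simp [hcol', hxP, hxX]
  have h12 : k + 1 ≠ k + 2 := (by decide : ∀ k : ZMod 3, k + 1 ≠ k + 2) k
  have h1 : k + 1 ≠ k := (by decide : ∀ k : ZMod 3, k + 1 ≠ k) k
  have h2 : k + 2 ≠ k := (by decide : ∀ k : ZMod 3, k + 2 ≠ k) k
  have split : ∀ x, x ∉ R \ (X ∪ P) → x ∉ R ∨ x ∈ X ∨ x ∈ P := fun x hx => by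
    simp only [Set.mem_sdiff, Set.mem_union] at hx; tauto
  have mixed : ∀ u s t : V, s ∉ R → (t ∈ X ∨ t ∈ P) → Triangle arc u s t → u ∉ R \ (X ∪ P) →
      col' u = col' s → col' s = col' t → False := by
    intro u s t hs ht hust hu e₁ e₂
    have htR : t ∈ R := ht.elim (@hX t) (@hP t)
    have htk : col' t ≠ k := by
      rcases ht with ht | ht
      · rwa [col_X t ht]
      · rwa [col_P t ht]
    have key : ∀ s, s ∉ R → ∀ c ∈ R, arc c s → col' s = k := fun s hs c hc hcs => by
      rw [col_D s hs]
      by_contra hk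
      exact hT.asymm hcs (h.dominates s hs (fun ho => hk (h.color s ho)) c hc)
    by_cases huR : u ∈ R
    · exact htk (e₂ ▸ key s hs u huR hust.1)
    · exact htk ((e₁.trans e₂) ▸ key u huR t htR hust.2.2)
  refine ⟨col', k + 2, ?_, ?_, col_P, ?_, ?_⟩
  · intro x hx hxP c hc
    rcases split x hx with hx | hx | hx
    · by_cases hxO : x ∈ O
      · exact hdom x (.inl hxO) c hc
      · exact h.dominates x hx hxO c hc.1
    · exact hdom x (.inr hx) c hc
    · exact absurd hx hxP
  · exact fun x hx hx' => hx'.2 (.inr hx)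
  · intro x hx
    obtain ⟨y, hy, hxy⟩ := harc x hx
    refine ⟨y, ?_, ?_, hxy⟩
    · exact fun hy' => hy.elim (fun h => h hy'.1) fun h => hy'.2 (.inl h)
    · exact fun hyP => hy.elim (fun h => h (hP hyP)) fun h => hdisj y h hyP
  · intro a b c ha hb hc ht e₁ e₂
    have e₃ : col' c = col' a := (e₁.trans e₂).symm
    by_cases hall : a ∉ R ∧ b ∉ R ∧ c ∉ R
    · obtain ⟨haR, hbR, hcR⟩ := hall
      rw [col_D a haR, col_D b hbR] at e₁
      rw [col_D b hbR, col_D c hcR] at e₂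
      exact h.not_mono a b c haR hbR hcR ht e₁ e₂
    · rcases split a ha with ha' | ha'
      · rcases split b hb with hb' | hb'
        · rcases split c hc with hc' | hc'
          · exact hall ⟨ha', hb', hc'⟩
          · exact mixed a b c hb' hc' ht ha e₁ e₂
        · exact mixed c a b ha' hb' ht.rotate.rotate hc e₃ e₁
      · rcases split c hc with hc' | hc'
        · exact mixed b c a hc' ha' ht.rotate hb e₂ e₃
        · rcases split b hb with hb' | hb'
          · exact mixed a b c hb' hc' ht ha e₁ e₂
          · rcases ha' with ha' | ha' <;> rcases hb' with hb' | hb' <;>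
              rcases hc' with hc' | hc' <;> simp only [*] at e₁ e₂ <;>
              first
                | exact h12 e₁ | exact h12 e₂ | exact h12 e₁.symm | exact h12 e₂.symm
                | exact hX' a ha' b hb' c hc' ht | exact hP' a ha' b hb' c hc' ht

/-- A partial colouring with uncoloured vertices extends to more vertices. -/
theorem PartialColoring.exists_smaller [Finite V] {arc : V → V → Prop} (hT : IsTournament arc)
    (hl : IsLight arc) {R O : Set V} {col : V → ZMod 3} {k : ZMod 3}
    (h : PartialColoring arc R O col k) (hR : R.Nonempty) :
    ∃ R' ⊂ R, ∃ O' col' k', PartialColoring arc R' O' col' k' := by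
  have shrink : ∀ {S : Set V}, (∃ x ∈ R, x ∈ S) → R \ S ⊂ R := fun ⟨x, hx, hxS⟩ =>
    ⟨Set.sdiff_subset, fun hsub => (hsub hx).2 hxS⟩
  by_cases hback : ∃ c ∈ R, ∃ x ∈ O, arc c x
  · obtain ⟨c₀, hc₀, x₀, hx₀, hcx₀⟩ := hback
    obtain ⟨e, he, hsink⟩ := exists_king hT.flip ⟨x₀, hx₀⟩
    have hsink : ∀ x ∈ O, x ≠ e → arc x e := fun x hx hne => hT.of_not hne.symm fun hex => by
      obtain ⟨w, hw, hwe, hxw⟩ := hsink x hx hex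
      exact h.not_mono e x w (h.notMem e he) (h.notMem x hx) (h.notMem w hw) ⟨hex, hxw, hwe⟩
        ((h.color e he).trans (h.color x hx).symm) ((h.color x hx).trans (h.color w hw).symm)
    obtain ⟨y, hyR, hyO, hey⟩ := h.exists_arc e he
    have he_out : ∀ c ∈ R, ¬ arc c e → arc e c := fun c hc hce =>
      hT.of_not (fun heq => h.notMem e he (heq ▸ hc)) hce
    have h_in : ∀ c ∈ R, ∀ x ∈ O, arc c x → ¬ arc c e → InTriangle (flip arc) e c :=
      fun c hc x hx hcx hce =>
        ⟨he_out c hc hce, x, hsink x hx fun heq => hce (heq ▸ hcx), hcx⟩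
    refine ⟨R \ ({c ∈ R | arc c e} ∪ {c ∈ R | InTriangle (flip arc) e c}), shrink ?_, _,
      h.extend hT (Set.sep_subset _ _) (Set.sep_subset _ _) ?_ ?_ ?_ ?_ ?_⟩
    · refine ⟨c₀, hc₀, ?_⟩
      by_cases hce : arc c₀ e
      · exact .inl ⟨hc₀, hce⟩
      · exact .inr ⟨hc₀, h_in c₀ hc₀ x₀ hx₀ hcx₀ hce⟩
    · exact Set.disjoint_left.2 fun c hc hc' => hT.asymm hc.2 hc'.2.1
    · have tri : ∀ c ∈ {c ∈ R | arc c e}, InTriangle arc e c := fun c hc =>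
        ⟨hc.2, y, hey, h.dominates y hyR hyO c hc.1⟩
      exact fun a ha b hb c hc =>
        not_triangle_of_inTriangle hT hl (tri a ha) (tri b hb) (tri c hc)
    · exact fun a ha b hb c hc =>
        not_triangle_of_flip_inTriangle hT hl ha.2 hb.2 hc.2
    · rintro x hx c ⟨hcR, hc⟩
      have hce : ¬ arc c e := fun hce => hc (.inl ⟨hcR, hce⟩)
      rcases hx with hx | hx
      · refine hT.of_not (fun heq => h.notMem x hx (heq ▸ hcR)) fun hcx => ?_
        exact hc (.inr ⟨hcR, h_in c hcR x hx hcx hce⟩)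
      · refine hT.of_not (fun heq => hc (.inl (heq ▸ hx))) fun hcx => ?_
        exact hc (.inr ⟨hcR, he_out c hcR hce, x, hx.2, hcx⟩)
    · rintro x ⟨-, -, w, hwe, hxw⟩
      refine ⟨w, ?_, hxw⟩
      by_cases hw : w ∈ R
      · exact .inr ⟨hw, hwe⟩
      · exact .inl hw
  · push Not at hback
    have hDR : ∀ x ∉ R, ∀ c ∈ R, arc x c := fun x hx c hc => by
      by_cases hxO : x ∈ O
      · exact hT.of_not (fun heq => hx (heq ▸ hc)) (hback c hc x hxO)
      · exact h.dominates x hx hxO c hc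
    obtain ⟨v, hv, hking⟩ := exists_king hT hR
    refine ⟨R \ ({c ∈ R | c = v ∨ arc c v} ∪ {c ∈ R | InTriangle (flip arc) v c}),
      shrink ⟨v, hv, .inl ⟨hv, .inl rfl⟩⟩, _,
      h.extend hT (Set.sep_subset _ _) (Set.sep_subset _ _) ?_ ?_ ?_ ?_ ?_⟩
    · refine Set.disjoint_left.2 fun c hc hc' => ?_
      rcases hc.2 with rfl | hcv
      · exact hT.1 _ hc'.2.1
      · exact hT.asymm hcv hc'.2.1
    · have no_arc : ∀ c ∈ {c ∈ R | c = v ∨ arc c v}, ¬ arc v c := fun c hc hvc => by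
        rcases hc.2 with rfl | hcv
        · exact hT.1 _ hvc
        · exact hT.asymm hcv hvc
      have tri : ∀ a ∈ {c ∈ R | c = v ∨ arc c v}, ∀ b ∈ {c ∈ R | c = v ∨ arc c v}, arc a b →
          InTriangle arc v a := fun a ha b hb hab => by
        rcases ha.2 with rfl | hav
        · exact absurd hab (no_arc b hb)
        · obtain ⟨w, -, hw⟩ := hking a ha.1 hav
          exact ⟨hav, w, hw⟩
      exact fun a ha b hb c hc ht => not_triangle_of_inTriangle hT hl (tri a ha b hb ht.1)
        (tri b hb c hc ht.2.1) (tri c hc a ha ht.2.2) ht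
    · exact fun a ha b hb c hc =>
        not_triangle_of_flip_inTriangle hT hl ha.2 hb.2 hc.2
    · rintro x hx c ⟨hcR, hc⟩
      rcases hx with hx | hx
      · exact hDR x (h.notMem x hx) c hcR
      · have hvc : arc v c := hT.of_not (fun heq => hc (.inl ⟨hcR, .inl heq⟩)) fun hcv =>
          hc (.inl ⟨hcR, .inr hcv⟩)
        rcases hx.2 with rfl | hxv
        · exact hvc
        · refine hT.of_not (fun heq => hc (.inl (heq ▸ hx))) fun hcx => ?_
          exact hc (.inr ⟨hcR, hvc, x, hxv, hcx⟩)
    · rintro x ⟨-, -, w, hwv, hxw⟩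
      refine ⟨w, ?_, hxw⟩
      by_cases hw : w ∈ R
      · exact .inr ⟨hw, .inr hwv⟩
      · exact .inl hw

theorem PartialColoring.exists_coloring [Finite V] {arc : V → V → Prop} (hT : IsTournament arc)
    (hl : IsLight arc) (R : Set V) : ∀ {O : Set V} {col : V → ZMod 3} {k : ZMod 3},
    PartialColoring arc R O col k → ∃ col' : V → ZMod 3, ∀ a b c, Triangle arc a b c →
      col' a = col' b → col' b = col' c → False := by
  induction R using WellFoundedLT.induction with
  | ind R ih =>
    intro O col k h
    rcases R.eq_empty_or_nonempty with rfl | hR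
    · exact ⟨col, fun a b c => h.not_mono a b c (by simp) (by simp) (by simp)⟩
    · obtain ⟨R', hR', O', col', k', h'⟩ := h.exists_smaller hT hl hR
      exact ih R' hR' h'

/-- The vertices of a light tournament can be coloured with three colours so that no triangle is
monochromatic. -/
theorem exists_three_coloring [Finite V] {arc : V → V → Prop} (hT : IsTournament arc)
    (hl : IsLight arc) : ∃ col : V → ZMod 3, ∀ a b c, Triangle arc a b c →
      col a = col b → col b = col c → False :=
  PartialColoring.exists_coloring hT hl Set.univ (O := ∅) (col := 0) (k := 0)
    ⟨by simp, by simp, by simp, by simp, by simp⟩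

/-- Every light tournament with nonnegative weights has a feedback vertex set of
weight at most `(3/4)·w(V(T))`. -/
theorem stmt9 [Fintype V] (arc : V → V → Prop) (hT : IsTournament arc)
    (hlight : IsLight arc) (w : V → ℚ) (hw : ∀ v, 0 ≤ w v) :
    ∃ F : Finset V, IsFVS arc (↑F : Set V) ∧
      (∑ v ∈ F, w v) ≤ 3 / 4 * ∑ v, w v := by
  obtain ⟨col, hcol⟩ := exists_three_coloring hT hlight
  have htotal : ∑ i : ZMod 3, ∑ v with col v = i, w v = ∑ v, w v :=
    Finset.sum_fiberwise _ _ _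
  obtain ⟨i, -, hi⟩ : ∃ i ∈ (Finset.univ : Finset (ZMod 3)),
      (∑ v, w v) / 3 ≤ ∑ v with col v = i, w v := by
    refine Finset.exists_le_of_sum_le Finset.univ_nonempty ?_
    rw [htotal, Finset.sum_const, Finset.card_univ, ZMod.card, nsmul_eq_mul]
    exact le_of_eq (by push_cast; ring)
  refine ⟨Finset.univ.filter fun v => ¬ col v = i, fun a b c ha hb hc ht => ?_, ?_⟩
  · simp only [Finset.coe_filter, Finset.mem_univ, true_and, Set.mem_ofPred_eq, not_not]
      at ha hb hc
    exact hcol a b c ht (ha.trans hb.symm) (hb.trans hc.symm)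
  · have hsplit := Finset.sum_filter_add_sum_filter_not Finset.univ (fun v => col v = i) w
    have hpos : 0 ≤ ∑ v, w v := Finset.sum_nonneg fun v _ => hw v
    linarith
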